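/- Fix a finite index type n, reals 0 ≤ γ < 1, 0 ≤ ε ≤ 1, and R_max ≥ 0. Let T be an n×n row-stochastic matrix and R_π a vector in ℝ^n with 0 ≤ R_π(s) ≤ R_max for all s. Then for every state s, ∑_{t=1}^∞ γ^{t−1} (T^{t−1} R_π)(s) − ∑_{t=1}^∞ γ^{t−1} (1−ε)^t (T^{t−1} R_π)(s) = ∑_{t=1}^∞ γ^{t−1} (1 − (1−ε)^t) (T^{t−1} R_π)(s), and this quantity is at most ∑_{t=1}^∞ γ^{t−1} (1 − (1−ε)^t) R_max = ε·R_max / ((1−γ)(1 − γ(1−ε))). -/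

import Mathlib

open Matrix

/-- A row-stochastic matrix maps vectors with entries in `[0, M]` to such vectors. -/
theorem Matrix.mulVec_mem_Icc_of_mem_rowStochastic {n : Type*} [Fintype n] [DecidableEq n]
    {A : Matrix n n ℝ} (hA : A ∈ rowStochastic ℝ n) {M : ℝ} {v : n → ℝ}
    (hv : ∀ i, v i ∈ Set.Icc 0 M) (i : n) : (A *ᵥ v) i ∈ Set.Icc 0 M := by
  rw [mem_rowStochastic_iff_sum] at hA
  refine ⟨Finset.sum_nonneg fun j _ => mul_nonneg (hA.1 i j) (hv j).1, ?_⟩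
  calc ∑ j, A i j * v j ≤ ∑ j, A i j * M :=
        Finset.sum_le_sum fun j _ => mul_le_mul_of_nonneg_left (hv j).2 (hA.1 i j)
    _ = M := by rw [← Finset.sum_mul, hA.2 i, one_mul]

/-- A discounted series with a bounded nonnegative coefficient sequence is summable. -/
theorem summable_pow_mul_of_mem_Icc {γ M : ℝ} (hγ0 : 0 ≤ γ) (hγ1 : γ < 1) {a : ℕ → ℝ}
    (ha : ∀ t, a t ∈ Set.Icc 0 M) : Summable fun t => γ ^ t * a t :=
  Summable.of_nonneg_of_le (fun t => mul_nonneg (pow_nonneg hγ0 t) (ha t).1)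
    (fun t => mul_le_mul_of_nonneg_left (ha t).2 (pow_nonneg hγ0 t))
    ((summable_geometric_of_lt_one hγ0 hγ1).mul_right M)

theorem hasSum_pow_mul_one_sub_pow_succ {γ δ : ℝ} (hγ0 : 0 ≤ γ) (hγ1 : γ < 1)
    (hδ0 : 0 ≤ δ) (hδ1 : δ ≤ 1) :
    HasSum (fun t : ℕ => γ ^ t * (1 - δ ^ (t + 1))) ((1 - δ) / ((1 - γ) * (1 - γ * δ))) := by
  have hγδ : γ * δ < 1 := (mul_le_of_le_one_right hγ0 hδ1).trans_lt hγ1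
  have h := (hasSum_geometric_of_lt_one hγ0 hγ1).sub
    ((hasSum_geometric_of_lt_one (mul_nonneg hγ0 hδ0) hγδ).mul_left δ)
  have h1 : 1 - γ ≠ 0 := (sub_pos.2 hγ1).ne'
  have h2 : 1 - γ * δ ≠ 0 := (sub_pos.2 hγδ).ne'
  have hval : (1 - γ)⁻¹ - δ * (1 - γ * δ)⁻¹ = (1 - δ) / ((1 - γ) * (1 - γ * δ)) := by
    rw [← div_eq_mul_inv, inv_eq_one_div, div_sub_div _ _ h1 h2]
    ring
  rw [← hval]
  exact h.congr_fun fun t => by ring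

/-- The chain of (in)equalities in the middle of the proof of Lemma 2: for a
row-stochastic `T` and rewards `R_π` in `[0, R_max]`, at each state `s`
(with the sums reindexed by `t = k + 1`),
`∑_{t≥1} γ^{t−1}(T^{t−1}R_π)(s) − ∑_{t≥1} γ^{t−1}(1−ε)^t (T^{t−1}R_π)(s)
  = ∑_{t≥1} γ^{t−1}(1 − (1−ε)^t)(T^{t−1}R_π)(s)
  ≤ ∑_{t≥1} γ^{t−1}(1 − (1−ε)^t) R_max = ε R_max / ((1−γ)(1 − γ(1−ε)))`. -/
theorem value_difference_chain {n : Type*} [Fintype n] [DecidableEq n]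
    (γ ε Rmax : ℝ) (hγ0 : 0 ≤ γ) (hγ1 : γ < 1) (hε0 : 0 ≤ ε) (hε1 : ε ≤ 1)
    (hRmax : 0 ≤ Rmax)
    (T : Matrix n n ℝ)
    (hT0 : ∀ i j, 0 ≤ T i j) (hT1 : ∀ i, ∑ j, T i j = 1)
    (Rπ : n → ℝ) (hRπ : ∀ s, 0 ≤ Rπ s ∧ Rπ s ≤ Rmax) :
    ∀ s : n,
      (∑' t : ℕ, γ ^ t * (T ^ t).mulVec Rπ s) -
          (∑' t : ℕ, γ ^ t * (1 - ε) ^ (t + 1) * (T ^ t).mulVec Rπ s) =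
        (∑' t : ℕ, γ ^ t * (1 - (1 - ε) ^ (t + 1)) * (T ^ t).mulVec Rπ s) ∧
      (∑' t : ℕ, γ ^ t * (1 - (1 - ε) ^ (t + 1)) * (T ^ t).mulVec Rπ s) ≤
        (∑' t : ℕ, γ ^ t * (1 - (1 - ε) ^ (t + 1)) * Rmax) ∧
      (∑' t : ℕ, γ ^ t * (1 - (1 - ε) ^ (t + 1)) * Rmax) =
        ε * Rmax / ((1 - γ) * (1 - γ * (1 - ε))) := by
  intro s
  have hv (t : ℕ) : (T ^ t).mulVec Rπ s ∈ Set.Icc 0 Rmax :=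
    mulVec_mem_Icc_of_mem_rowStochastic
      (pow_mem (mem_rowStochastic_iff_sum.2 ⟨hT0, hT1⟩) t) hRπ s
  have hδ0 : 0 ≤ 1 - ε := sub_nonneg.2 hε1
  have hδ1 : 1 - ε ≤ 1 := sub_le_self 1 hε0
  have hp0 (t : ℕ) : 0 ≤ (1 - ε) ^ (t + 1) := pow_nonneg hδ0 _
  have hp1 (t : ℕ) : (1 - ε) ^ (t + 1) ≤ 1 := pow_le_one₀ hδ0 hδ1
  have hs := summable_pow_mul_of_mem_Icc hγ0 hγ1 hv
  have hs' : Summable fun t : ℕ => γ ^ t * (1 - ε) ^ (t + 1) * (T ^ t).mulVec Rπ s := by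
    simp only [mul_assoc]
    exact summable_pow_mul_of_mem_Icc hγ0 hγ1 fun t =>
      ⟨mul_nonneg (hp0 t) (hv t).1, (mul_le_of_le_one_left (hv t).1 (hp1 t)).trans (hv t).2⟩
  have hdiff : HasSum (fun t : ℕ => γ ^ t * (1 - (1 - ε) ^ (t + 1)) * (T ^ t).mulVec Rπ s)
      ((∑' t : ℕ, γ ^ t * (T ^ t).mulVec Rπ s) -
        ∑' t : ℕ, γ ^ t * (1 - ε) ^ (t + 1) * (T ^ t).mulVec Rπ s) :=
    (hs.hasSum.sub hs'.hasSum).congr_fun fun t => by ring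
  have hbound := (hasSum_pow_mul_one_sub_pow_succ hγ0 hγ1 hδ0 hδ1).mul_right Rmax
  refine ⟨hdiff.tsum_eq.symm, hdiff.summable.tsum_le_tsum (fun t => ?_) hbound.summable, ?_⟩
  · exact mul_le_mul_of_nonneg_left (hv t).2
      (mul_nonneg (pow_nonneg hγ0 t) (sub_nonneg.2 (hp1 t)))
  · rw [hbound.tsum_eq, sub_sub_cancel, div_mul_eq_mul_div]
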